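/- arXiv:1502.02079 — 7 statements merged into one kernel-verified Lean document; each statement's English description precedes it below -/
import Mathlib

section
/- Let l_1, …, l_k ∈ ℤ^m be vectors generating a saturated sublattice L = ⊕_{i=1}^k ℤ·l_i of ℤ^m of rank k with L ∩ ℕ^m = {0}, and assume the k×m integer matrix whose rows are l_1, …, l_k is mixed dominating. Then the binomials x^{(l_1)_+} − x^{(l_1)_−}, …, x^{(l_k)_+} − x^{(l_k)_−} form a regular sequence in the polynomial ring ℂ[x_1, …, x_m]. -/
namespace MixedDominating

variable {ι κ : Type*}

/-- The columns in which row `a.1` of `M` is positive (if `a.2` is true) or negative. -/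
def side (M : ι → κ → ℤ) (a : ι × Bool) : Set κ :=
  {u | if a.2 then 0 < M a.1 u else M a.1 u < 0}

/-- The opposite side of the same row. -/
def flip (a : ι × Bool) : ι × Bool := (a.1, !a.2)

@[simp] lemma flip_fst (a : ι × Bool) : (flip a).1 = a.1 := rfl

@[simp] lemma flip_flip (a : ι × Bool) : flip (flip a) = a := by simp [flip]

lemma flip_ne (a : ι × Bool) : flip a ≠ a := by
  intro h
  have := congrArg Prod.snd h
  simp [flip] at this

lemma eq_or_eq_flip {a b : ι × Bool} (h : a.1 = b.1) : a = b ∨ a = flip b := by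
  obtain ⟨i, s⟩ := a
  obtain ⟨j, t⟩ := b
  obtain rfl : i = j := h
  cases s <;> cases t <;> simp [flip]

lemma exists_mem_side {M : ι → κ → ℤ} {i : ι} {u : κ} (h : M i u ≠ 0) :
    ∃ b, u ∈ side M (i, b) := by
  rcases lt_or_gt_of_ne h with h | h
  · exact ⟨false, by simpa [side] using h⟩
  · exact ⟨true, by simpa [side] using h⟩

/-- `a` links to `b` if the side opposite to `a` shares a column with the side `b`: after
crossing the row `a.1` starting from the side `a`, one may enter the side `b`. -/
def Links (M : ι → κ → ℤ) (a b : ι × Bool) : Prop :=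
  ∃ u, u ∈ side M (flip a) ∧ u ∈ side M b

lemma Links.symm_flip {M : ι → κ → ℤ} {a b : ι × Bool} (h : Links M a b) :
    Links M (flip b) (flip a) := by
  obtain ⟨u, h1, h2⟩ := h
  exact ⟨u, by simpa using h2, h1⟩

/-- A rainbow path: consecutive sides are linked and no row is crossed twice. -/
def IsRainbow (M : ι → κ → ℤ) (p : List (ι × Bool)) : Prop :=
  p.IsChain (Links M) ∧ (p.map Prod.fst).Nodup

/-- No rainbow path closes up to a cycle. -/
def NoRainbowCycle (M : ι → κ → ℤ) : Prop :=
  ∀ (a b : ι × Bool) (p : List (ι × Bool)), IsRainbow M p → p.head? = some a →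
    p.getLast? = some b → ¬ Links M b a

lemma IsRainbow.left {M : ι → κ → ℤ} {p q : List (ι × Bool)} (h : IsRainbow M (p ++ q)) :
    IsRainbow M p :=
  ⟨(List.isChain_append.1 h.1).1, by
    have := h.2
    rw [List.map_append] at this
    exact this.of_append_left⟩

lemma IsRainbow.right {M : ι → κ → ℤ} {p q : List (ι × Bool)} (h : IsRainbow M (p ++ q)) :
    IsRainbow M q :=
  ⟨(List.isChain_append.1 h.1).2.1, by
    have := h.2
    rw [List.map_append] at this
    exact this.of_append_right⟩

lemma IsRainbow.reverse_flip {M : ι → κ → ℤ} {p : List (ι × Bool)} (h : IsRainbow M p) :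
    IsRainbow M (p.map flip).reverse := by
  refine ⟨?_, ?_⟩
  · rw [List.isChain_reverse, List.isChain_map]
    exact h.1.imp fun _ _ hab => hab.symm_flip
  · rw [List.map_reverse, List.nodup_reverse, List.map_map]
    exact h.2

lemma isRainbow_append {M : ι → κ → ℤ} {p q : List (ι × Bool)} (hp : IsRainbow M p)
    (hq : IsRainbow M q)
    (hl : ∀ a ∈ p.getLast?, ∀ b ∈ q.head?, Links M a b)
    (hd : ∀ a ∈ p, ∀ b ∈ q, a.1 ≠ b.1) : IsRainbow M (p ++ q) := by
  refine ⟨List.isChain_append.2 ⟨hp.1, hq.1, hl⟩, ?_⟩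
  rw [List.map_append, List.nodup_append]
  refine ⟨hp.2, hq.2, ?_⟩
  intro x hx y hy
  obtain ⟨a, ha, rfl⟩ := List.mem_map.1 hx
  obtain ⟨b, hb, rfl⟩ := List.mem_map.1 hy
  exact hd a ha b hb

lemma IsRainbow.ne {M : ι → κ → ℤ} {p q : List (ι × Bool)} (h : IsRainbow M (p ++ q))
    {a b : ι × Bool} (ha : a ∈ p) (hb : b ∈ q) : a.1 ≠ b.1 := by
  have := h.2
  rw [List.map_append, List.nodup_append] at this
  exact this.2.2 _ (List.mem_map_of_mem ha) _ (List.mem_map_of_mem hb)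

lemma isRainbow_singleton (M : ι → κ → ℤ) (a : ι × Bool) : IsRainbow M [a] := by
  simp [IsRainbow]

/-- A rainbow path is safe if no rainbow continuation of its last side meets it again. -/
def IsSafe (M : ι → κ → ℤ) (p : List (ι × Bool)) (b : ι × Bool) : Prop :=
  ∀ q, IsRainbow M (b :: q) → IsRainbow M (p ++ b :: q)

/-- If all rainbow paths from `a` to the row of `b` enter it through `b`,
then these paths are safe. -/
lemma isSafe_of_unique_entry {M : ι → κ → ℤ} (hM : NoRainbowCycle M) {a b : ι × Bool}
    {p : List (ι × Bool)} (hp : IsRainbow M (p ++ [b])) (ha : p.head? = some a)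
    (hb : ∀ q c, q.head? = some a → IsRainbow M (q ++ [c]) → c.1 = b.1 → c = b) :
    IsSafe M p b := by
  intro q hq
  by_contra hcon
  have hmeet : ∃ x ∈ q, ∃ y ∈ p, x.1 = y.1 := by
    by_contra hno
    push Not at hno
    apply hcon
    refine isRainbow_append hp.left hq ?_ ?_
    · intro c hc d hd
      exact (List.isChain_append.1 hp.1).2.2 c hc d (by simpa using hd)
    · intro c hc d hd
      rcases List.mem_cons.1 hd with rfl | hd
      · exact hp.ne hc (by simp)
      · exact fun h => hno d hd c hc h.symm
  obtain ⟨x, q1, q2, hqq, hx, hq1⟩ : ∃ x q1 q2, q = q1 ++ x :: q2 ∧ (∃ y ∈ p, x.1 = y.1) ∧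
      ∀ z ∈ q1, ∀ y ∈ p, z.1 ≠ y.1 := by
    clear hq hcon
    induction q with
    | nil => simp at hmeet
    | cons z t ih =>
      by_cases hz : ∃ y ∈ p, z.1 = y.1
      · exact ⟨z, [], t, rfl, hz, by simp⟩
      · obtain ⟨x, hx, hxy⟩ := hmeet
        have hxt : x ∈ t := by
          rcases List.mem_cons.1 hx with rfl | h
          · exact absurd hxy hz
          · exact h
        obtain ⟨x', q1, q2, h1, h2, h3⟩ := ih ⟨x, hxt, hxy⟩
        refine ⟨x', z :: q1, q2, by simp [h1], h2, ?_⟩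
        intro w hw
        rcases List.mem_cons.1 hw with rfl | hw
        · push Not at hz
          exact hz
        · exact h3 w hw
  obtain ⟨y, hy, hxy⟩ := hx
  obtain ⟨p1, p2, rfl⟩ := List.append_of_mem hy
  have hq' : IsRainbow M ((b :: q1) ++ (x :: q2)) := by simpa [hqq] using hq
  have hlink : ∀ c ∈ (b :: q1).getLast?, Links M c x := fun c hc =>
    (List.isChain_append.1 hq'.1).2.2 c hc x (by simp)
  have hdisj : ∀ c ∈ p1 ++ y :: p2, ∀ d ∈ b :: q1, c.1 ≠ d.1 := by
    intro c hc d hd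
    rcases List.mem_cons.1 hd with rfl | hd
    · exact hp.ne hc (by simp)
    · exact (hq1 d hd c hc).symm
  rcases eq_or_eq_flip hxy with rfl | rfl
  · have hcyc : IsRainbow M ((x :: p2) ++ (b :: q1)) := by
      refine isRainbow_append (IsRainbow.right (p := p1) hp.left) hq'.left ?_ ?_
      · intro c hc d hd
        refine (List.isChain_append.1 hp.1).2.2 c ?_ d (by simpa using hd)
        rw [List.getLast?_append]
        simp [Option.mem_def.1 hc]
      · intro c hc d hd
        exact hdisj c (List.mem_append_right _ hc) d hd
    obtain ⟨c, hc⟩ : ∃ c, (b :: q1).getLast? = some c :=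
      ⟨_, List.getLast?_eq_some_getLast (by simp)⟩
    refine hM x c _ hcyc (by simp) ?_ (hlink c hc)
    rw [List.getLast?_append, hc]
    rfl
  · have hrev : IsRainbow M ((p1 ++ [y]) ++ ((b :: q1).map flip).reverse) := by
      refine isRainbow_append ?_ hq'.left.reverse_flip ?_ ?_
      · refine IsRainbow.left (q := p2 ++ [b]) ?_
        simpa using hp
      · intro c hc d hd
        obtain rfl : y = c := by simpa using hc
        rw [List.head?_reverse, List.getLast?_map] at hd
        obtain ⟨e, he, rfl⟩ := Option.map_eq_some_iff.1 (Option.mem_def.1 hd)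
        simpa using (hlink e he).symm_flip
      · intro c hc d hd
        obtain ⟨e, he, rfl⟩ := List.mem_map.1 (List.mem_reverse.1 hd)
        refine hdisj c ?_ e he
        simp only [List.mem_append, List.mem_cons, List.not_mem_nil, or_false] at hc ⊢
        tauto
    refine flip_ne b (hb (p1 ++ [y] ++ (q1.map flip).reverse) (flip b) ?_ ?_ rfl)
    · cases p1 <;> simpa using ha
    · simpa using hrev

/-- A row whose positive columns lie in `A`, whose negative columns lie outside `A`, while any
other row is supported either in `A` or in its complement. -/
def IsSplitting (M : ι → κ → ℤ) (r : ι) (A : Set κ) : Prop :=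
  (∀ u, 0 < M r u → u ∈ A) ∧ (∀ u, M r u < 0 → u ∉ A) ∧
    ∀ i, i ≠ r → (∀ u, M i u ≠ 0 → u ∈ A) ∨ (∀ u, M i u ≠ 0 → u ∉ A)

lemma exists_isSafe_of_not_isSplitting {M : ι → κ → ℤ} (hM : NoRainbowCycle M) (a : ι × Bool)
    (ha : ∀ A, ¬ IsSplitting M a.1 A) :
    ∃ p b, p.head? = some a ∧ IsRainbow M (p ++ [b]) ∧ IsSafe M p b := by
  let Reach : Set ι := {s | ∃ p b, p.head? = some a ∧ IsRainbow M (p ++ [b]) ∧ b.1 = s}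
  let A : Set κ := {u | u ∈ side M (flip a) ∨ ∃ s ∈ Reach, M s u ≠ 0}
  have hstart : ∀ u ∈ side M (flip a), ∀ i, i ≠ a.1 → M i u ≠ 0 → i ∈ Reach := by
    intro u hu i hi hiu
    obtain ⟨t, ht⟩ := exists_mem_side hiu
    refine ⟨[a], (i, t), rfl, ?_, rfl⟩
    refine isRainbow_append (isRainbow_singleton M a) (isRainbow_singleton M _) ?_ ?_
    · simpa using ⟨u, hu, ht⟩
    · simpa using hi.symm
  have hmem : ∀ p, p.head? = some a → IsRainbow M p → ∀ c ∈ p, c.1 = a.1 ∨ c.1 ∈ Reach := by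
    intro p hp hr c hc
    obtain ⟨p1, p2, rfl⟩ := List.append_of_mem hc
    cases p1 with
    | nil => left; simp at hp; rw [hp]
    | cons d t =>
      right
      refine ⟨d :: t, c, by simpa using hp, IsRainbow.left (q := p2) (by simpa using hr), rfl⟩
  -- a column of a reachable row through which one escapes from `A`
  have hesc : ∃ s ∈ Reach, ∃ u, M s u ≠ 0 ∧
      (u ∈ side M a ∨ ∃ i, i ∉ Reach ∧ i ≠ a.1 ∧ M i u ≠ 0) := by
    by_contra hno
    push Not at hno
    have hA : ∀ i, i ≠ a.1 → (∀ u, M i u ≠ 0 → u ∈ A) ∨ (∀ u, M i u ≠ 0 → u ∉ A) := by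
      intro i hi
      by_cases hir : i ∈ Reach
      · exact Or.inl fun u hu => Or.inr ⟨i, hir, hu⟩
      · refine Or.inr fun u hu huA => ?_
        rcases huA with h | ⟨s, hs, hsu⟩
        · exact hir (hstart u h i hi hu)
        · exact hu ((hno s hs u hsu).2 i hir hi)
    have hout : ∀ u ∈ side M a, u ∉ A := by
      rintro u hu (h | ⟨s, hs, hsu⟩)
      · unfold side flip at *
        grind
      · exact (hno s hs u hsu).1 hu
    have hin : ∀ u ∈ side M (flip a), u ∈ A := fun u hu => Or.inl hu
    obtain ⟨r, t⟩ := a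
    cases t
    · refine ha A ⟨?_, ?_, hA⟩
      · intro u hu; exact hin u (by simpa [side, flip] using hu)
      · intro u hu; exact hout u (by simpa [side] using hu)
    · refine ha Aᶜ ⟨?_, ?_, ?_⟩
      · intro u hu; exact hout u (by simpa [side] using hu)
      · intro u hu; exact not_not_intro (hin u (by simpa [side, flip] using hu))
      · intro i hi
        rcases hA i hi with h | h
        · exact Or.inr fun u hu => not_not_intro (h u hu)
        · exact Or.inl fun u hu => h u hu
  obtain ⟨s, hs, u, hsu, hu⟩ := hesc
  have hnot : ∀ q c, q.head? = some a → IsRainbow M (q ++ [c]) → c.1 = s →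
      u ∉ side M (flip c) := by
    intro q c hq hr hc huc
    have hhead : (q ++ [c]).head? = some a := by rw [List.head?_append, hq]; rfl
    rcases hu with hu | ⟨i, hir, hia, hiu⟩
    · exact hM a c _ hr hhead (by simp) ⟨u, huc, hu⟩
    · obtain ⟨t, ht⟩ := exists_mem_side hiu
      refine hir ⟨q ++ [c], (i, t), hhead, ?_, rfl⟩
      refine isRainbow_append hr (isRainbow_singleton M _) ?_ ?_
      · simpa using ⟨u, huc, ht⟩
      · intro d hd e he
        obtain rfl : e = (i, t) := by simpa using he
        intro hdi
        rcases hmem _ hhead hr d hd with h | h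
        · exact hia (by rw [← h]; exact hdi.symm)
        · exact hir (by rwa [show d.1 = i from hdi] at h)
  obtain ⟨p, b, hp, hr, hb⟩ := hs
  refine ⟨p, b, hp, hr, isSafe_of_unique_entry hM hr hp ?_⟩
  intro q c hq hrc hcb
  refine (eq_or_eq_flip hcb).resolve_right ?_
  rintro rfl
  have h1 := hnot q _ hq hrc (by simpa using hb)
  have h2 := hnot p b hp hr hb
  obtain ⟨t, ht⟩ := exists_mem_side hsu
  rcases eq_or_eq_flip (a := (s, t)) (b := b) hb.symm with h | h
  · rw [flip_flip] at h1
    exact h1 (h ▸ ht)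
  · exact h2 (h ▸ ht)

/-- A variant of Yeo's theorem on properly coloured cycles. -/
theorem exists_isSplitting [Finite ι] [Nonempty ι] {M : ι → κ → ℤ} (hM : NoRainbowCycle M) :
    ∃ r A, IsSplitting M r A := by
  by_contra! hno
  have hlong : ∀ n : ℕ, ∃ p b, n ≤ p.length ∧ IsSafe M p b := by
    intro n
    induction n with
    | zero =>
      obtain ⟨r⟩ := ‹Nonempty ι›
      exact ⟨[], (r, true), le_rfl, fun q hq => hq⟩
    | succ n ih =>
      obtain ⟨p, b, hn, hs⟩ := ih
      obtain ⟨p', c, hp', -, hs'⟩ := exists_isSafe_of_not_isSplitting hM b (hno b.1)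
      obtain ⟨t, rfl⟩ : ∃ t, p' = b :: t := by
        cases p' with
        | nil => simp at hp'
        | cons d t => exact ⟨t, by simp at hp'; rw [hp']⟩
      refine ⟨p ++ b :: t, c, by simp; omega, ?_⟩
      intro q hq
      simpa using hs _ (hs' q hq)
  have := Fintype.ofFinite ι
  obtain ⟨p, b, hn, hs⟩ := hlong (Fintype.card ι + 1)
  have h := (hs [] (isRainbow_singleton M b)).2.length_le_card
  simp at h
  omega

/-- A rainbow path is mixed on a set of columns of size one less than its length, except at
its ends. -/
lemma exists_columns_of_isChain [DecidableEq κ] {M : ι → κ → ℤ} (p : List (ι × Bool))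
    (a : ι × Bool) (h : (a :: p).IsChain (Links M)) :
    ∃ U : Finset κ, U.card ≤ p.length ∧ (∀ b ∈ p, ∃ u ∈ U, u ∈ side M b) ∧
      ∀ b ∈ a :: p, b ∈ (a :: p).getLast? ∨ ∃ u ∈ U, u ∈ side M (flip b) := by
  induction p generalizing a with
  | nil => exact ⟨∅, by simp⟩
  | cons c t ih =>
    rw [List.isChain_cons_cons] at h
    obtain ⟨⟨u, hu1, hu2⟩, h2⟩ := h
    obtain ⟨U, hU, hin, hout⟩ := ih c h2
    refine ⟨insert u U, ?_, ?_, ?_⟩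
    · have := Finset.card_insert_le u U
      simp
      omega
    · intro b hb
      rcases List.mem_cons.1 hb with rfl | hb
      · exact ⟨u, by simp, hu2⟩
      · obtain ⟨v, hv, hv'⟩ := hin b hb
        exact ⟨v, by simp [hv], hv'⟩
    · intro b hb
      rcases List.mem_cons.1 hb with rfl | hb
      · exact Or.inr ⟨u, by simp, hu1⟩
      · rcases hout b hb with h | ⟨v, hv, hv'⟩
        · exact Or.inl (by simpa using h)
        · exact Or.inr ⟨v, by simp [hv], hv'⟩

/-- A mixed dominating matrix has no rainbow cycle. -/
theorem noRainbowCycle_of_mixed_dominating {M : ι → κ → ℤ}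
    (hmd : ∀ (I : Finset ι) (U : Finset κ), I.Nonempty → I.card = U.card →
      ∃ i ∈ I, ¬ ((∃ u ∈ U, 0 < M i u) ∧ (∃ u ∈ U, M i u < 0))) : NoRainbowCycle M := by
  classical
  intro a b p hp ha hb ⟨u, hu1, hu2⟩
  obtain ⟨t, rfl⟩ : ∃ t, p = a :: t := by
    cases p with
    | nil => simp at ha
    | cons d t => exact ⟨t, by simp at ha; rw [ha]⟩
  obtain ⟨U, hU, hin, hout⟩ := exists_columns_of_isChain t a hp.1
  have hmix : ∀ c ∈ a :: t, (∃ v ∈ insert u U, v ∈ side M c) ∧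
      (∃ v ∈ insert u U, v ∈ side M (flip c)) := by
    intro c hc
    constructor
    · rcases List.mem_cons.1 hc with rfl | hc
      · exact ⟨u, by simp, hu2⟩
      · obtain ⟨v, hv, hv'⟩ := hin c hc
        exact ⟨v, by simp [hv], hv'⟩
    · rcases hout c hc with h | ⟨v, hv, hv'⟩
      · rw [hb] at h
        obtain rfl : b = c := by simpa using h
        exact ⟨u, by simp, hu1⟩
      · exact ⟨v, by simp [hv], hv'⟩
  have hcard : (insert u U).card ≤ ((a :: t).map Prod.fst).toFinset.card := by
    rw [List.toFinset_card_of_nodup hp.2]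
    have := Finset.card_insert_le u U
    simp
    omega
  obtain ⟨I, hI, hIc⟩ := Finset.exists_subset_card_eq hcard
  obtain ⟨i, hi, hni⟩ := hmd I (insert u U)
    (Finset.card_pos.1 (by rw [hIc]; exact Finset.card_pos.2 (by simp))) hIc
  obtain ⟨c, hc, rfl⟩ := List.mem_map.1 (List.mem_toFinset.1 (hI hi))
  apply hni
  obtain ⟨h1, h2⟩ := hmix c hc
  obtain ⟨j, s⟩ := c
  cases s
  · exact ⟨by simpa [side, flip] using h2, by simpa [side] using h1⟩
  · exact ⟨by simpa [side] using h1, by simpa [side, flip] using h2⟩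

lemma mkQ_toNat_sub (L : Submodule ℤ (κ → ℤ)) (t : κ → ℤ) :
    L.mkQ (fun j => ((t j).toNat : ℤ)) - L.mkQ (fun j => ((-(t j)).toNat : ℤ)) = L.mkQ t := by
  rw [← map_sub]
  congr 1
  funext j
  simp only [Pi.sub_apply]
  omega

section Binomials

variable [Fintype κ] (K : Type*) [CommRing K]

/-- The monomial with exponent vector `u`. -/
noncomputable def mon (u : κ → ℕ) : MvPolynomial κ K := ∏ j, MvPolynomial.X j ^ u j

/-- The binomial `x^{t₊} - x^{t₋}` of an integer vector `t`. -/
noncomputable def binomial (t : κ → ℤ) : MvPolynomial κ K :=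
  (∏ j, MvPolynomial.X j ^ (t j).toNat) - ∏ j, MvPolynomial.X j ^ (-(t j)).toNat

lemma mon_add (u v : κ → ℕ) : mon K (u + v) = mon K u * mon K v := by
  simp [mon, pow_add, Finset.prod_mul_distrib]

lemma mon_nsmul (n : ℕ) (u : κ → ℕ) : mon K (n • u) = mon K u ^ n := by
  simp [mon, pow_mul', Finset.prod_pow]

lemma monomial_eq_C_mul_mon (u : κ →₀ ℕ) (c : K) :
    MvPolynomial.monomial u c = MvPolynomial.C c * mon K u := by
  rw [MvPolynomial.monomial_eq, Finsupp.prod_fintype _ _ (by simp)]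
  rfl

/-- The binomials of a mixed dominating matrix generate all binomials of its row lattice. -/
theorem mon_sub_mon_mem_span {M : ι → κ → ℤ}
    (hmd : ∀ (I : Finset ι) (U : Finset κ), I.Nonempty → I.card = U.card →
      ∃ i ∈ I, ¬ ((∃ u ∈ U, 0 < M i u) ∧ (∃ u ∈ U, M i u < 0)))
    (I : Finset ι) (u v : κ → ℕ) (c : ι → ℤ)
    (h : ∀ j, (u j : ℤ) - v j = ∑ i ∈ I, c i * M i j) :
    mon K u - mon K v ∈ Ideal.span ((fun i => binomial K (M i)) '' (I : Set ι)) := by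
  classical
  induction I using Finset.strongInduction generalizing u v c with
  | H I ih =>
  rcases I.eq_empty_or_nonempty with rfl | hI
  · obtain rfl : u = v := by
      funext j
      have := h j
      simp at this
      omega
    simp
  have := hI.to_subtype
  have hcyc : NoRainbowCycle (fun i : I => M i) := by
    refine noRainbowCycle_of_mixed_dominating fun J U hJ hc => ?_
    obtain ⟨i, hi, hni⟩ := hmd (J.map (Function.Embedding.subtype _)) U (by simpa using hJ)
      (by simpa using hc)
    obtain ⟨j, hj, rfl⟩ := Finset.mem_map.1 hi
    exact ⟨j, hj, hni⟩
  obtain ⟨⟨r, hr⟩, A, hpos, hneg, hrest⟩ := exists_isSplitting hcyc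
  have key : ∀ (u v : κ → ℕ) (c : ι → ℤ), 0 ≤ c r →
      (∀ j, (u j : ℤ) - v j = ∑ i ∈ I, c i * M i j) →
      mon K u - mon K v ∈ Ideal.span ((fun i => binomial K (M i)) '' (I : Set ι)) := by
    clear h u v c
    intro u v c hc h
    let IA := I.filter fun i => i ≠ r ∧ ∀ j, M i j ≠ 0 → j ∈ A
    let IB := I.filter fun i => i ≠ r ∧ ¬ ∀ j, M i j ≠ 0 → j ∈ A
    have hsub : ∀ J ⊆ I, r ∉ J → J ⊂ I := fun J hJ hrJ =>
      Finset.ssubset_iff_subset_ne.2 ⟨hJ, fun he => hrJ (he ▸ hr)⟩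
    have hIA : IA ⊂ I := hsub _ (Finset.filter_subset _ _) (by simp [IA])
    have hIB : IB ⊂ I := hsub _ (Finset.filter_subset _ _) (by simp [IB])
    have hsplit : ∀ j, ∑ i ∈ I, c i * M i j =
        c r * M r j + ∑ i ∈ IA, c i * M i j + ∑ i ∈ IB, c i * M i j := by
      intro j
      have hone : c r * M r j = ∑ i ∈ I, if i = r then c i * M i j else 0 := by
        rw [Finset.sum_ite_eq' I r, if_pos hr]
      rw [hone, Finset.sum_filter, Finset.sum_filter, ← Finset.sum_add_distrib,
        ← Finset.sum_add_distrib]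
      refine Finset.sum_congr rfl fun i _ => ?_
      by_cases h1 : i = r
      · simp [h1]
      · by_cases h2 : ∀ j, M i j ≠ 0 → j ∈ A
        · rw [if_neg h1, if_pos ⟨h1, h2⟩, if_neg fun h => h.2 h2]
          ring
        · rw [if_neg h1, if_neg fun h => h2 h.2, if_pos ⟨h1, h2⟩]
          ring
    have hA0 : ∀ j ∉ A, ∑ i ∈ IA, c i * M i j = 0 := by
      intro j hj
      refine Finset.sum_eq_zero fun i hi => ?_
      have hi' := (Finset.mem_filter.1 hi).2.2 j
      have : M i j = 0 := by
        by_contra hne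
        exact hj (hi' hne)
      simp [this]
    have hB0 : ∀ j ∈ A, ∑ i ∈ IB, c i * M i j = 0 := by
      intro j hj
      refine Finset.sum_eq_zero fun i hi => ?_
      obtain ⟨hiI, hir, hi'⟩ := Finset.mem_filter.1 hi
      have hout := (hrest ⟨i, hiI⟩ (by simpa using hir)).resolve_left hi' j
      have : M i j = 0 := by
        by_contra hne
        exact hout hne hj
      simp [this]
    let z : κ → ℕ := fun j => if j ∈ A then v j else u j
    let pos : κ → ℕ := fun j => (M r j).toNat
    let neg : κ → ℕ := fun j => (-(M r j)).toNat
    let n := (c r).toNat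
    have hn : (n : ℤ) = c r := Int.toNat_of_nonneg hc
    have hin : ∀ j ∈ A, (pos j : ℤ) = M r j ∧ neg j = 0 := by
      intro j hj
      have : ¬ M r j < 0 := fun hlt => hneg j hlt hj
      simp only [pos, neg]
      omega
    have hout : ∀ j ∉ A, (neg j : ℤ) = - M r j ∧ pos j = 0 := by
      intro j hj
      have : ¬ 0 < M r j := fun hlt => hj (hpos j hlt)
      simp only [pos, neg]
      omega
    have hmono : ∀ J ⊂ I, Ideal.span ((fun i => binomial K (M i)) '' (J : Set ι)) ≤
        Ideal.span ((fun i => binomial K (M i)) '' (I : Set ι)) := fun J hJ =>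
      Ideal.span_mono (Set.image_mono (by exact_mod_cast hJ.1))
    have e1 : mon K u - mon K (z + n • pos) ∈
        Ideal.span ((fun i => binomial K (M i)) '' (I : Set ι)) := by
      refine hmono IA hIA (ih IA hIA u _ c fun j => ?_)
      have h1 := h j
      rw [hsplit] at h1
      by_cases hj : j ∈ A
      · rw [hB0 j hj] at h1
        simp only [Pi.add_apply, Pi.smul_apply, smul_eq_mul, z, hj, if_true]
        push_cast
        rw [(hin j hj).1, hn]
        linarith
      · rw [hA0 j hj]
        simp [z, hj, (hout j hj).2]
    have e2 : mon K (z + n • pos) - mon K (z + n • neg) ∈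
        Ideal.span ((fun i => binomial K (M i)) '' (I : Set ι)) := by
      rw [mon_add, mon_add, mon_nsmul, mon_nsmul, ← mul_sub]
      refine Ideal.mul_mem_left _ _ (Ideal.mem_of_dvd _ (sub_dvd_pow_sub_pow _ _ n) ?_)
      exact Ideal.subset_span ⟨r, hr, rfl⟩
    have e3 : mon K (z + n • neg) - mon K v ∈
        Ideal.span ((fun i => binomial K (M i)) '' (I : Set ι)) := by
      refine hmono IB hIB (ih IB hIB _ v c fun j => ?_)
      have h1 := h j
      rw [hsplit] at h1
      by_cases hj : j ∈ A
      · rw [hB0 j hj]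
        simp [z, hj, (hin j hj).2]
      · rw [hA0 j hj] at h1
        simp only [Pi.add_apply, Pi.smul_apply, smul_eq_mul, z, hj, if_false]
        push_cast
        rw [(hout j hj).1, hn]
        linarith
    have := Ideal.add_mem _ (Ideal.add_mem _ e1 e2) e3
    simpa using this
  rcases le_total 0 (c r) with hc | hc
  · exact key u v c hc h
  · rw [← neg_sub]
    refine neg_mem (key v u (-c) (by simpa using hc) fun j => ?_)
    simp only [Pi.neg_apply, neg_mul, Finset.sum_neg_distrib, ← h j]
    ring

variable {K}

/-- In a group algebra, the difference of two group elements is not a zero divisor if their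
quotient has infinite order. -/
lemma eq_zero_of_single_sub_single_mul_eq_zero {G : Type*} [AddCommGroup G] {a b : G}
    (hab : ∀ n : ℕ, n • (a - b) = 0 → n = 0) {y : AddMonoidAlgebra K G}
    (h : (AddMonoidAlgebra.single a 1 - AddMonoidAlgebra.single b 1) * y = 0) : y = 0 := by
  have hshift : ∀ z, y.coeff (z + (a - b)) = y.coeff z := by
    intro z
    have hz := congrArg (fun w => AddMonoidAlgebra.coeff w (z + a)) h
    simp only [sub_mul, AddMonoidAlgebra.coeff_sub, Finsupp.sub_apply,
      AddMonoidAlgebra.coeff_single_mul_apply, one_mul, AddMonoidAlgebra.coeff_zero,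
      Finsupp.zero_apply] at hz
    rw [show -a + (z + a) = z by abel, show -b + (z + a) = z + (a - b) by abel] at hz
    exact (sub_eq_zero.1 hz).symm
  have hshiftn : ∀ (n : ℕ) z, y.coeff (z + n • (a - b)) = y.coeff z := by
    intro n z
    induction n with
    | zero => simp
    | succ n ih => rw [succ_nsmul, ← add_assoc, hshift, ih]
  by_contra hy
  obtain ⟨z, hz⟩ : ∃ z, y.coeff z ≠ 0 := by
    by_contra! hno
    exact hy (AddMonoidAlgebra.coeff_eq_zero.1 (Finsupp.ext hno))
  have hinj : Function.Injective fun n : ℕ => z + n • (a - b) := by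
    have key : ∀ p q : ℕ, p ≤ q → z + p • (a - b) = z + q • (a - b) → p = q := by
      intro p q hpq he
      obtain ⟨d, rfl⟩ := Nat.exists_eq_add_of_le hpq
      have hd : d • (a - b) = 0 := by
        rw [add_nsmul] at he
        simpa using add_left_cancel he
      simp [hab d hd]
    intro p q he
    rcases le_total p q with hpq | hpq
    · exact key p q hpq he
    · exact (key q p hpq he.symm).symm
  refine Set.infinite_of_injective_forall_mem hinj (s := (y.coeff.support : Set G)) ?_
    (Finset.finite_toSet _)
  intro n
  simpa [hshiftn] using hz

/-- The map from polynomials to the group algebra of `ℤ^κ / L` sending each monomial to the class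
of its exponent vector. -/
noncomputable def toGroupAlgebra [DecidableEq κ] (K : Type*) [CommRing K]
    (L : Submodule ℤ (κ → ℤ)) :
    MvPolynomial κ K →ₐ[K] AddMonoidAlgebra K ((κ → ℤ) ⧸ L) :=
  MvPolynomial.aeval fun j => AddMonoidAlgebra.single (L.mkQ (Pi.single j 1)) 1

lemma toGroupAlgebra_mon [DecidableEq κ] (L : Submodule ℤ (κ → ℤ)) (u : κ → ℕ) :
    toGroupAlgebra K L (mon K u) =
      AddMonoidAlgebra.single (L.mkQ fun j => (u j : ℤ)) 1 := by
  simp only [toGroupAlgebra, mon, map_prod, map_pow, MvPolynomial.aeval_X,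
    AddMonoidAlgebra.single_pow, one_pow, AddMonoidAlgebra.prod_single, Finset.prod_const_one]
  congr 1
  simp only [← map_nsmul, ← map_sum]
  congr 1
  funext j
  simp [Finset.sum_apply, Pi.single_apply]

lemma toGroupAlgebra_binomial [DecidableEq κ] (L : Submodule ℤ (κ → ℤ)) (t : κ → ℤ) :
    toGroupAlgebra K L (binomial K t) =
      AddMonoidAlgebra.single (L.mkQ fun j => ((t j).toNat : ℤ)) 1 -
        AddMonoidAlgebra.single (L.mkQ fun j => ((-(t j)).toNat : ℤ)) 1 := by
  rw [← toGroupAlgebra_mon, ← toGroupAlgebra_mon, ← map_sub]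
  rfl

/-- An ideal containing all binomials of the lattice `L` contains the kernel of the map to the
group algebra. -/
lemma mem_of_toGroupAlgebra_eq_zero [DecidableEq κ] {L : Submodule ℤ (κ → ℤ)}
    {J : Ideal (MvPolynomial κ K)}
    (hJ : ∀ u v : κ → ℕ, (fun j => (u j : ℤ) - v j) ∈ L → mon K u - mon K v ∈ J)
    {p : MvPolynomial κ K} (hp : toGroupAlgebra K L p = 0) : p ∈ J := by
  classical
  let rep : (κ → ℤ) ⧸ L → MvPolynomial κ K := fun g =>
    if h : ∃ u : κ → ℕ, L.mkQ (fun j => (u j : ℤ)) = g then mon K h.choose else 0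
  let s : AddMonoidAlgebra K ((κ → ℤ) ⧸ L) → MvPolynomial κ K := fun y =>
    Finsupp.linearCombination K rep y.coeff
  have hs : ∀ q, s (toGroupAlgebra K L q) - q ∈ J := by
    intro q
    induction q using MvPolynomial.induction_on' with
    | monomial u c =>
      have hex : ∃ w : κ → ℕ, L.mkQ (fun j => (w j : ℤ)) = L.mkQ (fun j => (u j : ℤ)) :=
        ⟨u, rfl⟩
      have hmem : mon K hex.choose - mon K u ∈ J := by
        refine hJ _ _ ?_
        exact (Submodule.Quotient.eq L).1 hex.choose_spec
      rw [monomial_eq_C_mul_mon, ← MvPolynomial.smul_eq_C_mul, map_smul, toGroupAlgebra_mon]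
      have : s (c • AddMonoidAlgebra.single (L.mkQ fun j => (u j : ℤ)) 1) =
          c • mon K hex.choose := by
        simp only [s, AddMonoidAlgebra.coeff_smul, map_smul, AddMonoidAlgebra.coeff_single,
          Finsupp.linearCombination_single, one_smul, rep]
        rw [dif_pos hex]
      rw [this, ← smul_sub, MvPolynomial.smul_eq_C_mul]
      exact J.mul_mem_left _ hmem
    | add p q hp hq =>
      have : s (toGroupAlgebra K L (p + q)) - (p + q) =
          (s (toGroupAlgebra K L p) - p) + (s (toGroupAlgebra K L q) - q) := by
        simp only [s, map_add, AddMonoidAlgebra.coeff_add]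
        ring
      rw [this]
      exact J.add_mem hp hq
  have h0 := hs p
  rw [hp] at h0
  simpa [s] using h0

/-- For linearly independent rows of a mixed dominating matrix, each binomial is regular modulo
the binomials of any set of other rows. -/
theorem mem_span_of_binomial_mul_mem {M : ι → κ → ℤ} (hindep : LinearIndependent ℤ M)
    (hmd : ∀ (I : Finset ι) (U : Finset κ), I.Nonempty → I.card = U.card →
      ∃ i ∈ I, ¬ ((∃ u ∈ U, 0 < M i u) ∧ (∃ u ∈ U, M i u < 0)))
    {I : Finset ι} {r : ι} (hr : r ∉ I) {p : MvPolynomial κ K}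
    (hp : binomial K (M r) * p ∈
      Ideal.span ((fun i => binomial K (M i)) '' (I : Set ι))) :
    p ∈ Ideal.span ((fun i => binomial K (M i)) '' (I : Set ι)) := by
  classical
  let L : Submodule ℤ (κ → ℤ) := Submodule.span ℤ (M '' I)
  refine mem_of_toGroupAlgebra_eq_zero (L := L) ?_ ?_
  · intro u v huv
    obtain ⟨c, hc⟩ := (Submodule.mem_span_image_finset_iff_exists_fun ℤ).1 huv
    refine mon_sub_mon_mem_span K hmd I u v (fun i => if h : i ∈ I then c ⟨i, h⟩ else 0) ?_
    intro j
    have := congrFun hc j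
    simp only [Finset.sum_apply, Pi.smul_apply, smul_eq_mul] at this
    rw [← this, ← Finset.sum_coe_sort I]
    refine Finset.sum_congr rfl fun i _ => ?_
    simp
  · have hker : Ideal.span ((fun i => binomial K (M i)) '' (I : Set ι)) ≤
        RingHom.ker (toGroupAlgebra K L) := by
      rw [Ideal.span_le]
      rintro _ ⟨i, hi, rfl⟩
      rw [SetLike.mem_coe, RingHom.mem_ker, toGroupAlgebra_binomial, sub_eq_zero]
      congr 1
      rw [← sub_eq_zero, mkQ_toNat_sub, Submodule.mkQ_apply, Submodule.Quotient.mk_eq_zero]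
      exact Submodule.subset_span ⟨i, hi, rfl⟩
    have h0 := RingHom.mem_ker.1 (hker hp)
    rw [map_mul, toGroupAlgebra_binomial] at h0
    refine eq_zero_of_single_sub_single_mul_eq_zero (fun n hn => ?_) h0
    rw [mkQ_toNat_sub, ← map_nsmul, Submodule.mkQ_apply, Submodule.Quotient.mk_eq_zero] at hn
    have := linearIndependent_iff_eq_zero_of_smul_mem_span.1 hindep r n ?_
    · exact_mod_cast this
    · rw [natCast_zsmul]
      refine Submodule.span_mono (Set.image_mono ?_) hn
      intro i hi
      refine ⟨trivial, ?_⟩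
      rintro rfl
      exact hr hi

end Binomials

end MixedDominating

/-- Fischer–Shapiro / Mavlyutov.  Let `l 1, …, l k ∈ ℤ^m` be
ℤ-linearly independent vectors spanning a saturated sublattice `L` of `ℤ^m` with
`L ∩ ℕ^m = {0}`, and assume the `k × m` integer matrix with rows `l 1, …, l k` is
mixed dominating (no square submatrix has a positive and a negative entry in every
row).  Then the binomials `x^{(l i)₊} - x^{(l i)₋}` form a regular sequence in
`ℂ[x_1, …, x_m]`. -/
theorem binomials_regular_sequence_of_mixed_dominating
    (k m : ℕ) (l : Fin k → (Fin m → ℤ))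
    (hindep : LinearIndependent ℤ l)
    (hsat : NoZeroSMulDivisors ℤ ((Fin m → ℤ) ⧸ Submodule.span ℤ (Set.range l)))
    (hnonneg : ∀ x ∈ Submodule.span ℤ (Set.range l), (∀ j : Fin m, 0 ≤ x j) → x = 0)
    (hmd : ∀ (I : Finset (Fin k)) (U : Finset (Fin m)), I.Nonempty → I.card = U.card →
      ∃ i ∈ I, ¬ ((∃ u ∈ U, 0 < l i u) ∧ (∃ u ∈ U, l i u < 0))) :
    RingTheory.Sequence.IsRegular (R := MvPolynomial (Fin m) ℂ) (MvPolynomial (Fin m) ℂ)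
      (List.ofFn fun i : Fin k =>
        (∏ j : Fin m, MvPolynomial.X j ^ (l i j).toNat) -
        (∏ j : Fin m, MvPolynomial.X j ^ (-(l i j)).toNat)) := by
  change RingTheory.Sequence.IsRegular (MvPolynomial (Fin m) ℂ)
    (List.ofFn fun i => MixedDominating.binomial ℂ (l i))
  refine ⟨⟨fun i hi => ?_⟩, fun htop => ?_⟩
  · have hik : i < k := by simpa using hi
    have hideal : Ideal.ofList
        (List.take i (List.ofFn fun i => MixedDominating.binomial ℂ (l i))) =
        Ideal.span ((fun i => MixedDominating.binomial ℂ (l i)) ''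
          (Finset.Iio (⟨i, hik⟩ : Fin k) : Set (Fin k))) := by
      refine congrArg Ideal.span (Set.ext fun f => ?_)
      simp only [Set.mem_ofPred_eq, List.mem_take_iff_getElem, List.getElem_ofFn,
        List.length_ofFn, Set.mem_image, Finset.coe_Iio, Set.mem_Iio]
      constructor
      · rintro ⟨j, hj, rfl⟩
        exact ⟨⟨j, by omega⟩, by simpa [Fin.lt_def] using by omega, rfl⟩
      · rintro ⟨j, hj, rfl⟩
        exact ⟨j, by simp only [Fin.lt_def] at hj; omega, rfl⟩
    rw [isSMulRegular_quotient_iff_mem_of_smul_mem]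
    intro p hp
    simp only [smul_eq_mul, Ideal.mul_top, List.getElem_ofFn] at hp ⊢
    rw [hideal] at hp ⊢
    exact MixedDominating.mem_span_of_binomial_mul_mem hindep hmd (by simp) hp
  · have hle : Ideal.ofList (List.ofFn fun i => MixedDominating.binomial ℂ (l i)) ≤
        RingHom.ker (MvPolynomial.eval fun _ : Fin m => (1 : ℂ)) := by
      refine Ideal.span_le.2 fun f hf => ?_
      obtain ⟨i, rfl⟩ := (List.mem_ofFn' _ _).1 hf
      simp [MixedDominating.binomial, RingHom.mem_ker]
    rw [smul_eq_mul, Ideal.mul_top] at htop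
    have h1 := hle (htop ▸ Submodule.mem_top (x := (1 : MvPolynomial (Fin m) ℂ)))
    simp [RingHom.mem_ker] at h1
end

section
/- Let Σ[1] = E_1 ⊔ … ⊔ E_{k+1} be a finite subset of M partitioned into pairwise disjoint nonempty subsets, let V = {v_1, …, v_k} be an amenable collection subordinate to E_1, …, E_{k+1}, and assume that for every nonzero v ∈ N there exists ρ ∈ Σ[1] with ⟨v, ρ⟩ < 0. Then in the polynomial ring ℂ[x_ρ : ρ ∈ Σ[1]], the k binomials B_i = ∏_{ρ ∈ E_i} x_ρ − ∏_{ρ ∈ Σ[1], ⟨v_i,ρ⟩ > 0} x_ρ^{⟨v_i, ρ⟩} (for i = 1, …, k) form a regular sequence. -/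
namespace MvPolynomial

open RingTheory.Sequence
open scoped Pointwise

section BinomialQuotient

variable {υ A : Type*} [CommRing A] {d : υ →₀ ℕ}

/-- A multiple of `x ^ d - c` in which no monomial divisible by `x ^ d` occurs is trivial. -/
theorem eq_zero_of_coeff_mul_monomial_sub_C (hd : d ≠ 0) (c : A) {g : MvPolynomial υ A}
    (h : ∀ e, d ≤ e → coeff e (g * (monomial d 1 - C c)) = 0) : g = 0 := by
  by_contra hg
  obtain ⟨e, he, hmax⟩ := g.support.exists_max_image Finsupp.degree
    (Finset.nonempty_iff_ne_empty.mpr (support_eq_empty.not.mpr hg))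
  have hed : coeff (e + d) g = 0 := by
    by_contra hne
    have hle := hmax _ (mem_support_iff.mpr hne)
    have hpos : Finsupp.degree d ≠ 0 := (Finsupp.degree_eq_zero_iff d).not.mpr hd
    rw [map_add] at hle
    omega
  have key := h (e + d) le_add_self
  rw [mul_sub, coeff_sub, coeff_mul_monomial, mul_comm g (C c), coeff_C_mul, hed] at key
  exact mem_support_iff.mp he (by simpa using key)

theorem isSMulRegular_monomial_sub_C (hd : d ≠ 0) (c : A) :
    IsSMulRegular (MvPolynomial υ A) (monomial d 1 - C c : MvPolynomial υ A) := by
  refine (isSMulRegular_iff_right_eq_zero_of_smul).mpr fun g hg => ?_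
  refine eq_zero_of_coeff_mul_monomial_sub_C hd c fun e _ => ?_
  rw [mul_comm, ← smul_eq_mul, hg, coeff_zero]

theorem monomial_mem_sup_span_monomial_sub_C (hd : d ≠ 0) (c : A) (e : υ →₀ ℕ) (a : A) :
    monomial e a ∈ (Ideal.span {(monomial d 1 - C c : MvPolynomial υ A)}).restrictScalars A ⊔
      restrictSupport A {e | ¬ d ≤ e} := by
  induction hn : Finsupp.degree e using Nat.strong_induction_on generalizing e a with
  | _ n ih =>
    by_cases hde : d ≤ e
    · obtain ⟨e, rfl⟩ := exists_add_of_le hde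
      have hpos : Finsupp.degree d ≠ 0 := (Finsupp.degree_eq_zero_iff d).not.mpr hd
      have hsplit : monomial (d + e) a =
          monomial e a * (monomial d 1 - C c) + monomial e (a * c) := by
        rw [mul_sub, monomial_mul, mul_comm _ (C c), C_mul_monomial, add_comm e d, mul_one,
          mul_comm c a, sub_add_cancel]
      rw [hsplit]
      refine Submodule.add_mem _ (Submodule.mem_sup_left ?_) (ih _ ?_ e _ rfl)
      · exact Ideal.mul_mem_left _ _ (Ideal.mem_span_singleton_self _)
      · rw [← hn, map_add]; omega
    · exact Submodule.mem_sup_right ((monomial_mem_restrictSupport A).mpr (Or.inl hde))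

theorem isCompl_span_monomial_sub_C (hd : d ≠ 0) (c : A) :
    IsCompl ((Ideal.span {(monomial d 1 - C c : MvPolynomial υ A)}).restrictScalars A)
      (restrictSupport A {e | ¬ d ≤ e}) := by
  constructor
  · rw [Submodule.disjoint_def]
    intro f hf hsupp
    obtain ⟨g, rfl⟩ := Ideal.mem_span_singleton'.mp hf
    have hg : g = 0 := eq_zero_of_coeff_mul_monomial_sub_C hd c fun e hde => by
      by_contra hne
      exact (mem_restrictSupport_iff A).mp hsupp (mem_support_iff.mpr hne) hde
    rw [hg, zero_mul]
  · rw [codisjoint_iff, eq_top_iff]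
    intro f _
    rw [f.as_sum]
    exact Submodule.sum_mem _ fun e _ => monomial_mem_sup_span_monomial_sub_C hd c e _

theorem free_quotient_span_monomial_sub_C (hd : d ≠ 0) (c : A) :
    Module.Free A (MvPolynomial υ A ⧸ Ideal.span {(monomial d 1 - C c : MvPolynomial υ A)}) :=
  have := Module.Free.of_basis (basisRestrictSupport A {e : υ →₀ ℕ | ¬ d ≤ e})
  .of_equiv (Submodule.quotientEquivOfIsCompl _ _ (isCompl_span_monomial_sub_C hd c)).symm

/-- A weakly regular sequence of the coefficient ring stays weakly regular after prepending
`x ^ d - c`, because `A[x] / (x ^ d - c)` is free over `A`. -/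
theorem isWeaklyRegular_monomial_sub_C_cons (hd : d ≠ 0) (c : A) {rs : List A}
    (hrs : IsWeaklyRegular A rs) :
    IsWeaklyRegular (MvPolynomial υ A) ((monomial d 1 - C c) :: rs.map C) := by
  set f : MvPolynomial υ A := monomial d 1 - C c
  refine .cons' (isSMulRegular_monomial_sub_C hd c) ?_
  have := free_quotient_span_monomial_sub_C hd c
  have hflat := hrs.of_flat (S := MvPolynomial υ A ⧸ Ideal.span {f})
  have hI : (f • ⊤ : Submodule (MvPolynomial υ A) (MvPolynomial υ A)) = Ideal.span {f} := by
    rw [← Submodule.ideal_span_singleton_smul, smul_eq_mul, Ideal.mul_top]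
  let e : (MvPolynomial υ A ⧸ Ideal.span {f}) ≃+ QuotSMulTop f (MvPolynomial υ A) :=
    (Submodule.quotEquivOfEq _ _ hI.symm).toAddEquiv
  rw [List.map_map]
  refine (AddEquiv.isWeaklyRegular_congr (e := e) ?_).mp hflat
  rw [List.forall₂_map_left_iff, List.forall₂_map_right_iff, List.forall₂_same]
  intro r _ x
  obtain ⟨x, rfl⟩ := Ideal.Quotient.mk_surjective x
  rfl

end BinomialQuotient

section SplitVariables

variable {σ : Type*} (R : Type*) [CommRing R] (p : σ → Prop) [DecidablePred p]

/-- Regard polynomials as polynomials in the variables satisfying `p`, whose coefficients are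
polynomials in the remaining variables. -/
noncomputable def splitEquiv :
    MvPolynomial {s // p s} (MvPolynomial {s // ¬ p s} R) ≃ₐ[R] MvPolynomial σ R :=
  (sumAlgEquiv R _ _).symm.trans (renameEquiv R (Equiv.sumCompl p))

variable {R}

theorem splitEquiv_C (q : MvPolynomial {s // ¬ p s} R) :
    splitEquiv R p (C q) = rename Subtype.val q := by
  induction q using MvPolynomial.induction_on with
  | C a => simp [splitEquiv]
  | add q₁ q₂ h₁ h₂ => simp only [map_add, h₁, h₂]
  | mul_X q s h => simp only [map_mul, h]; simp [splitEquiv]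

theorem splitEquiv_monomial_one (d : {s // p s} →₀ ℕ) :
    splitEquiv R p (monomial d 1) = monomial (d.mapDomain Subtype.val) 1 := by
  rw [← rename_monomial, monomial_eq, monomial_eq, C_1, C_1, one_mul, one_mul, Finsupp.prod,
    Finsupp.prod, map_prod, map_prod]
  refine Finset.prod_congr rfl fun s _ => ?_
  simp [splitEquiv]

end SplitVariables

theorem _root_.RingEquiv.isWeaklyRegular_map {A B : Type*} [CommRing A] [CommRing B] (φ : A ≃+* B)
    {rs : List A} (h : IsWeaklyRegular A rs) : IsWeaklyRegular B (rs.map φ) :=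
  (AddEquiv.isWeaklyRegular_congr (e := φ.toAddEquiv) <|
    List.forall₂_map_right_iff.mpr <| List.forall₂_same.mpr fun r _ x => map_mul φ r x).mp h

theorem _root_.Finsupp.mapDomain_val_subtypeDomain {σ N : Type*} [AddCommMonoid N] {p : σ → Prop}
    (d : σ →₀ N) (h : ∀ s ∈ d.support, p s) :
    (d.subtypeDomain p).mapDomain Subtype.val = d := by
  have hcomap : d.subtypeDomain p = d.comapDomain Subtype.val Subtype.val_injective.injOn := by
    ext s
    rfl
  rw [hcomap]
  exact Finsupp.mapDomain_comapDomain _ Subtype.val_injective d fun s hs => ⟨⟨s, h s hs⟩, rfl⟩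

/-- Binomials `x ^ d i - x ^ e i` such that `x ^ d i` only involves variables of level `i` and
`x ^ e i` only variables of level larger than `i` form a weakly regular sequence. -/
theorem isWeaklyRegular_ofFn_monomial_sub_monomial {R : Type*} [CommRing R] {σ : Type*} {k : ℕ}
    (level : σ → ℕ) (d e : Fin k → σ →₀ ℕ) (hd : ∀ i, d i ≠ 0)
    (hdl : ∀ i, ∀ s ∈ (d i).support, level s = i)
    (hel : ∀ i, ∀ s ∈ (e i).support, i < level s) :
    IsWeaklyRegular (MvPolynomial σ R)
      (List.ofFn fun i => (monomial (d i) 1 - monomial (e i) 1 : MvPolynomial σ R)) := by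
  classical
  induction k generalizing σ with
  | zero => simp
  | succ k ih =>
    let p : σ → Prop := fun s => level s = 0
    have hd0 := Finsupp.mapDomain_val_subtypeDomain (p := p) (d 0) (hdl 0)
    have hds (i : Fin k) := Finsupp.mapDomain_val_subtypeDomain (p := fun s => ¬ p s) (d i.succ)
      fun s hs => by simp [p, hdl i.succ s hs]
    have he (i : Fin (k + 1)) := Finsupp.mapDomain_val_subtypeDomain (p := fun s => ¬ p s) (e i)
      fun s hs => (Nat.zero_lt_of_lt (hel i s hs)).ne'
    have htail := ih (fun s : {s // ¬ p s} => level s - 1)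
      (fun i => (d i.succ).subtypeDomain _) (fun i => (e i.succ).subtypeDomain _)
      (fun i h0 => hd i.succ (by rw [← hds, h0, Finsupp.mapDomain_zero]))
      (fun i s hs => by
        have := hdl i.succ s (by simpa using hs)
        simp [this])
      (fun i s hs => by
        have := hel i.succ s (by simpa using hs)
        rw [Fin.val_succ] at this
        omega)
    have hreg := isWeaklyRegular_monomial_sub_C_cons
      (fun h0 => hd 0 (by rw [← hd0, h0, Finsupp.mapDomain_zero]))
      (monomial ((e 0).subtypeDomain fun s => ¬ p s) (1 : R)) htail (d := (d 0).subtypeDomain p)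
    let φ := splitEquiv R p
    have hmap := φ.toRingEquiv.isWeaklyRegular_map hreg
    refine Eq.mp (congrArg _ (Eq.symm ?_)) hmap
    rw [List.ofFn_succ, List.map_cons, List.map_map, List.map_ofFn]
    congr 1
    · change _ = φ _
      rw [map_sub, splitEquiv_monomial_one, splitEquiv_C, rename_monomial, hd0, he]
    · congr 1
      funext i
      change _ = φ (C _)
      rw [splitEquiv_C, map_sub, rename_monomial, rename_monomial, hds, he]

end MvPolynomial


/-- Let `Σ[1] = S = E 1 ⊔ … ⊔ E (k+1)` be a finite subset of
`M = Fin n → ℤ` partitioned into pairwise disjoint nonempty subsets, let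
`v 1, …, v k` be an amenable collection subordinate to `E 1, …, E (k+1)`, and
assume every nonzero `w ∈ N` pairs negatively with some `ρ ∈ S` (completeness of the
fan).  Then in `ℂ[x_ρ : ρ ∈ S]` the binomials
`B i = ∏_{ρ ∈ E i} x_ρ - ∏_{ρ ∈ S, ⟨v i, ρ⟩ > 0} x_ρ^{⟨v i, ρ⟩}` form a
regular sequence. -/
theorem amenable_binomials_regular_sequence
    (n k : ℕ)
    (E : Fin (k + 1) → Finset (Fin n → ℤ))
    (hE_ne : ∀ j, (E j).Nonempty)
    (hE_disj : ∀ j j' : Fin (k + 1), j ≠ j' → Disjoint (E j) (E j'))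
    (S : Finset (Fin n → ℤ))
    (hS : ∀ ρ, ρ ∈ S ↔ ∃ j : Fin (k + 1), ρ ∈ E j)
    (v : Fin k → ((Fin n → ℤ) →ₗ[ℤ] ℤ))
    (hv1 : ∀ i : Fin k, ∀ ρ ∈ E i.castSucc, v i ρ = -1)
    (hv2 : ∀ i : Fin k, ∀ j : Fin (k + 1), i.castSucc < j → ∀ ρ ∈ E j, 0 ≤ v i ρ)
    (hv3 : ∀ i : Fin k, ∀ j : Fin (k + 1), j < i.castSucc → ∀ ρ ∈ E j, v i ρ = 0)
    (hcomplete : ∀ w : (Fin n → ℤ) →ₗ[ℤ] ℤ, w ≠ 0 → ∃ ρ ∈ S, w ρ < 0) :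
    RingTheory.Sequence.IsRegular (R := MvPolynomial S ℂ) (MvPolynomial S ℂ)
      (List.ofFn fun i : Fin k =>
        (∏ ρ ∈ S.attach.filter (fun ρ => ρ.1 ∈ E i.castSucc), MvPolynomial.X ρ) -
        (∏ ρ ∈ S.attach.filter (fun ρ => 0 < v i ρ.1),
          MvPolynomial.X ρ ^ (v i ρ.1).toNat)) := by
  classical
  have hmem (ρ : S) : ∃ j, ρ.1 ∈ E j := (hS ρ.1).mp ρ.2
  choose level hlevel using hmem
  have hlevel_eq (ρ : S) (j : Fin (k + 1)) (h : ρ.1 ∈ E j) : level ρ = j := by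
    by_contra hne
    exact Finset.disjoint_left.mp (hE_disj _ _ hne) (hlevel ρ) h
  have hlt (i : Fin k) (ρ : S) (h : 0 < v i ρ.1) : i.castSucc < level ρ := by
    rcases lt_trichotomy (level ρ) i.castSucc with hl | hl | hl
    · exact absurd (hv3 i _ hl _ (hlevel ρ)) h.ne'
    · have := hv1 i ρ.1 (hl ▸ hlevel ρ)
      omega
    · exact hl
  constructor
  · have hreg := MvPolynomial.isWeaklyRegular_ofFn_monomial_sub_monomial (R := ℂ)
      (fun ρ : S => (level ρ : ℕ))
      (fun i : Fin k => ∑ ρ ∈ S.attach.filter (fun ρ => ρ.1 ∈ E i.castSucc), Finsupp.single ρ 1)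
      (fun i => ∑ ρ ∈ S.attach.filter (fun ρ => 0 < v i ρ.1),
        Finsupp.single ρ (v i ρ.1).toNat) ?_ ?_ ?_
    · simpa only [MvPolynomial.monomial_sum_one, ← MvPolynomial.X_pow_eq_monomial, pow_one]
        using hreg
    · intro i h0
      obtain ⟨ρ, hρ⟩ := hE_ne i.castSucc
      have := DFunLike.congr_fun h0 ⟨ρ, (hS ρ).mpr ⟨_, hρ⟩⟩
      simp [Finsupp.finsetSum_apply, Finsupp.single_apply, hρ] at this
    · intro i s hs
      obtain ⟨ρ, hρ, hsρ⟩ := Finset.mem_biUnion.mp (Finsupp.support_finsetSum hs)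
      obtain rfl := Finset.mem_singleton.mp (Finsupp.support_single_subset hsρ)
      rw [hlevel_eq s _ (Finset.mem_filter.mp hρ).2, Fin.val_castSucc]
    · intro i s hs
      obtain ⟨ρ, hρ, hsρ⟩ := Finset.mem_biUnion.mp (Finsupp.support_finsetSum hs)
      obtain rfl := Finset.mem_singleton.mp (Finsupp.support_single_subset hsρ)
      exact hlt i s (Finset.mem_filter.mp hρ).2
  · -- All the binomials vanish at the point with every coordinate equal to `1`.
    intro htop
    have hle : Ideal.ofList (List.ofFn fun i : Fin k =>
        (∏ ρ ∈ S.attach.filter (fun ρ => ρ.1 ∈ E i.castSucc), MvPolynomial.X ρ) -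
        (∏ ρ ∈ S.attach.filter (fun ρ => 0 < v i ρ.1),
          MvPolynomial.X ρ ^ (v i ρ.1).toNat)) ≤
        RingHom.ker (MvPolynomial.eval fun _ : S => (1 : ℂ)) := by
      refine Ideal.span_le.mpr fun f hf => ?_
      obtain ⟨i, rfl⟩ := (List.mem_ofFn' _ _).mp hf
      simp [RingHom.mem_ker]
    rw [smul_eq_mul, Ideal.mul_top] at htop
    exact RingHom.ker_ne_top _ (top_le_iff.mp (htop.trans_le hle))
end

section
/- Let Σ[1] = E_1 ⊔ … ⊔ E_{k+1} be a finite subset of M partitioned into pairwise disjoint nonempty subsets and let V = {v_1, …, v_k} be an amenable collection subordinate to E_1, …, E_{k+1}. Then the k × Σ[1] integer matrix T with entries T_{i,ρ} = ⟨v_i, ρ⟩ is mixed dominating: for every subset I ⊆ {1, …, k} and every subset U ⊆ Σ[1] with |I| = |U| ≥ 1, there exists i ∈ I such that the entries ⟨v_i, ρ⟩ for ρ ∈ U do not include both a positive and a negative value. -/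
/-- Let `Σ[1] = E 1 ⊔ … ⊔ E (k+1)` be a finite subset of
`M = Fin n → ℤ` partitioned into pairwise disjoint nonempty subsets and let
`v 1, …, v k` be an amenable collection subordinate to it.  Then the matrix
`T (i, ρ) = ⟨v i, ρ⟩` (rows indexed by `1, …, k`, columns by `Σ[1]`) is mixed
dominating: for every subset `I` of rows and every subset `U ⊆ Σ[1]` of columns with
`|I| = |U| ≥ 1`, some row `i ∈ I` does not contain both a positive and a negative
entry among the columns `U`. -/
theorem amenable_matrix_mixed_dominating
    (n k : ℕ)
    (E : Fin (k + 1) → Finset (Fin n → ℤ))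
    (hE_ne : ∀ j, (E j).Nonempty)
    (hE_disj : ∀ j j' : Fin (k + 1), j ≠ j' → Disjoint (E j) (E j'))
    (v : Fin k → ((Fin n → ℤ) →ₗ[ℤ] ℤ))
    (hv1 : ∀ i : Fin k, ∀ ρ ∈ E i.castSucc, v i ρ = -1)
    (hv2 : ∀ i : Fin k, ∀ j : Fin (k + 1), i.castSucc < j → ∀ ρ ∈ E j, 0 ≤ v i ρ)
    (hv3 : ∀ i : Fin k, ∀ j : Fin (k + 1), j < i.castSucc → ∀ ρ ∈ E j, v i ρ = 0) :
    ∀ (I : Finset (Fin k)) (U : Finset (Fin n → ℤ)),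
      (∀ ρ ∈ U, ∃ j : Fin (k + 1), ρ ∈ E j) →
      I.card = U.card → U.Nonempty →
      ∃ i ∈ I, ¬ ((∃ ρ ∈ U, 0 < v i ρ) ∧ (∃ ρ ∈ U, v i ρ < 0)) := by
  intro I U hU hcard hne
  by_contra! hmixed
  have hneg : ∀ i ∈ I, ∃ ρ ∈ U, ρ ∈ E i.castSucc := by
    intro i hi
    obtain ⟨ρ, hρ, hlt⟩ := (hmixed i hi).2
    obtain ⟨j, hj⟩ := hU ρ hρ
    rcases lt_trichotomy i.castSucc j with h | rfl | h
    · exact absurd hlt (hv2 i j h ρ hj).not_gt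
    · exact ⟨ρ, hρ, hj⟩
    · exact absurd (hv3 i j h ρ hj) hlt.ne
  choose! f hfU hfE using hneg
  have hinj : Set.InjOn f I := by
    intro a ha b hb hab
    by_contra hne'
    have hdisj := hE_disj a.castSucc b.castSucc (by simpa using hne')
    exact Finset.disjoint_left.mp hdisj (hfE a ha) (hab ▸ hfE b hb)
  have hsurj : Set.SurjOn f I U :=
    Finset.surjOn_of_injOn_of_card_le f hfU hinj hcard.ge
  have hI : I.Nonempty := Finset.card_pos.mp (hcard ▸ hne.card_pos)
  obtain ⟨ρ, hρ, hpos⟩ := (hmixed _ (I.max'_mem hI)).1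
  obtain ⟨a, ha, rfl⟩ := hsurj hρ
  rcases (I.le_max' a ha).lt_or_eq with h | h
  · exact hpos.ne' (hv3 _ a.castSucc (by simpa using h) _ (hfE a ha))
  · rw [← h, hv1 a _ (hfE a ha)] at hpos
    exact absurd hpos (by norm_num)
end

section
/- Let Σ[1] = E_1 ⊔ … ⊔ E_{k+1} be a finite subset of M partitioned into pairwise disjoint nonempty subsets and let V = {v_1, …, v_k} be an amenable collection subordinate to E_1, …, E_{k+1}. Then the vectors l_1, …, l_k ∈ ℤ^{Σ[1]} defined by l_i = (⟨v_i, ρ⟩)_{ρ ∈ Σ[1]} are ℤ-linearly independent and span a saturated sublattice of ℤ^{Σ[1]}, i.e. the quotient ℤ^{Σ[1]} / span_ℤ(l_1, …, l_k) is torsion-free. -/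
/-- If the evaluations of the rows `l i` at the points `p j` form a triangular matrix with `-1` on
the diagonal, then any divisor of all entries of `∑ i, c i • l i` divides every `c i`. -/
theorem dvd_coeff_of_dvd_sum_of_triangular {k : ℕ} {ι : Type*} (l : Fin k → ι → ℤ)
    (p : Fin k → ι) (hdiag : ∀ i, l i (p i) = -1) (hzero : ∀ i j, j < i → l i (p j) = 0)
    (c : Fin k → ℤ) (a : ℤ) (h : ∀ x, a ∣ (∑ i, c i • l i) x) (j : Fin k) : a ∣ c j := by
  induction j using WellFoundedLT.induction with
  | ind j ih =>
    have hj := h (p j)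
    simp only [Finset.sum_apply, Pi.smul_apply, smul_eq_mul] at hj
    rw [← Finset.add_sum_erase _ _ (Finset.mem_univ j), hdiag] at hj
    have hrest : a ∣ ∑ i ∈ Finset.univ.erase j, c i * l i (p j) := by
      refine Finset.dvd_sum fun i hi => ?_
      rcases lt_or_gt_of_ne (Finset.ne_of_mem_erase hi) with hij | hij
      · exact (ih i hij).mul_right _
      · simp [hzero i j hij]
    simpa using (dvd_add_left hrest).mp hj

/-- Rows that are triangular with `-1` on the diagonal at some points are linearly independent. -/
theorem linearIndependent_of_triangular {k : ℕ} {ι : Type*} (l : Fin k → ι → ℤ)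
    (p : Fin k → ι) (hdiag : ∀ i, l i (p i) = -1) (hzero : ∀ i j, j < i → l i (p j) = 0) :
    LinearIndependent ℤ l := by
  refine Fintype.linearIndependent_iff.mpr fun c hc i => ?_
  exact zero_dvd_iff.mp
    (dvd_coeff_of_dvd_sum_of_triangular l p hdiag hzero c 0 (fun x => by rw [hc]; simp) i)

/-- Rows that are triangular with `-1` on the diagonal at some points span a saturated
sublattice. -/
theorem noZeroSMulDivisors_quotient_span_of_triangular {k : ℕ} {ι : Type*} (l : Fin k → ι → ℤ)
    (p : Fin k → ι) (hdiag : ∀ i, l i (p i) = -1) (hzero : ∀ i j, j < i → l i (p j) = 0) :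
    NoZeroSMulDivisors ℤ ((ι → ℤ) ⧸ Submodule.span ℤ (Set.range l)) := by
  refine ⟨fun {a q} haq => or_iff_not_imp_left.mpr fun ha => ?_⟩
  obtain ⟨x, rfl⟩ := Submodule.Quotient.mk_surjective _ q
  rw [← Submodule.Quotient.mk_smul, Submodule.Quotient.mk_eq_zero,
    Submodule.mem_span_range_iff_exists_fun] at haq
  obtain ⟨c, hc⟩ := haq
  choose d hd using dvd_coeff_of_dvd_sum_of_triangular l p hdiag hzero c a
    (fun y => by rw [hc]; simp)
  rw [Submodule.Quotient.mk_eq_zero, Submodule.mem_span_range_iff_exists_fun]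
  refine ⟨d, smul_right_injective _ ha ?_⟩
  simp only [← hc, Finset.smul_sum, smul_smul, hd]

/-- Let `Σ[1] = S = E 1 ⊔ … ⊔ E (k+1)` be a finite subset of
`M = Fin n → ℤ` partitioned into pairwise disjoint nonempty subsets and let
`v 1, …, v k` be an amenable collection subordinate to it.  Then the vectors
`l i = (⟨v i, ρ⟩)_{ρ ∈ S} ∈ ℤ^S` are ℤ-linearly independent and span a saturated
sublattice of `ℤ^S` (the quotient is torsion-free). -/
theorem amenable_rows_independent_and_saturated
    (n k : ℕ)
    (E : Fin (k + 1) → Finset (Fin n → ℤ))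
    (hE_ne : ∀ j, (E j).Nonempty)
    (hE_disj : ∀ j j' : Fin (k + 1), j ≠ j' → Disjoint (E j) (E j'))
    (S : Finset (Fin n → ℤ))
    (hS : ∀ ρ, ρ ∈ S ↔ ∃ j : Fin (k + 1), ρ ∈ E j)
    (v : Fin k → ((Fin n → ℤ) →ₗ[ℤ] ℤ))
    (hv1 : ∀ i : Fin k, ∀ ρ ∈ E i.castSucc, v i ρ = -1)
    (hv2 : ∀ i : Fin k, ∀ j : Fin (k + 1), i.castSucc < j → ∀ ρ ∈ E j, 0 ≤ v i ρ)
    (hv3 : ∀ i : Fin k, ∀ j : Fin (k + 1), j < i.castSucc → ∀ ρ ∈ E j, v i ρ = 0) :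
    LinearIndependent ℤ (fun i : Fin k => fun ρ : S => v i ρ.1) ∧
    NoZeroSMulDivisors ℤ
      ((S → ℤ) ⧸ Submodule.span ℤ (Set.range (fun i : Fin k => fun ρ : S => v i ρ.1))) := by
  choose r hr using hE_ne
  let p : Fin k → S := fun i => ⟨r i.castSucc, (hS _).mpr ⟨_, hr _⟩⟩
  have hdiag : ∀ i, v i (p i).1 = -1 := fun i => hv1 i _ (hr _)
  have hzero : ∀ i j, j < i → v i (p j).1 = 0 := fun i j hij =>
    hv3 i _ (Fin.castSucc_lt_castSucc_iff.mpr hij) _ (hr _)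
  exact ⟨linearIndependent_of_triangular _ p hdiag hzero,
    noZeroSMulDivisors_quotient_span_of_triangular _ p hdiag hzero⟩
end

section
/- Let Σ[1] = E_1 ⊔ … ⊔ E_{k+1} be a finite subset of M partitioned into pairwise disjoint nonempty subsets and let V = {v_1, …, v_k} be an amenable collection subordinate to E_1, …, E_{k+1}. Let U be a nonempty finite subset of Σ[1] and let a_u be strictly positive rational numbers for u ∈ U. If the element p = Σ_{u ∈ U} a_u u of M ⊗_ℤ ℚ satisfies ⟨v_j, p⟩ = 0 for every j = 1, …, k, then U ∩ E_{k+1} ≠ ∅. -/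
/-- Lemma on cones meeting the orthogonal subspace.  Let
`Σ[1] = E 1 ⊔ … ⊔ E (k+1) ⊆ M = Fin n → ℤ` be partitioned into pairwise disjoint
nonempty finite subsets with amenable collection `v 1, …, v k`.  Let `U ⊆ Σ[1]` be a
nonempty finite subset and `a u > 0` rational numbers for `u ∈ U`.  If the element
`p = Σ_{u ∈ U} a u • u` of `M ⊗ ℚ` is orthogonal to every `v j` (i.e.
`Σ_{u ∈ U} a u * ⟨v j, u⟩ = 0` for all `j`), then `U ∩ E (k+1) ≠ ∅`. -/
theorem amenable_orthogonal_combination_meets_last_part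
    (n k : ℕ)
    (E : Fin (k + 1) → Finset (Fin n → ℤ))
    (hE_ne : ∀ j, (E j).Nonempty)
    (hE_disj : ∀ j j' : Fin (k + 1), j ≠ j' → Disjoint (E j) (E j'))
    (v : Fin k → ((Fin n → ℤ) →ₗ[ℤ] ℤ))
    (hv1 : ∀ i : Fin k, ∀ ρ ∈ E i.castSucc, v i ρ = -1)
    (hv2 : ∀ i : Fin k, ∀ j : Fin (k + 1), i.castSucc < j → ∀ ρ ∈ E j, 0 ≤ v i ρ)
    (hv3 : ∀ i : Fin k, ∀ j : Fin (k + 1), j < i.castSucc → ∀ ρ ∈ E j, v i ρ = 0)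
    (U : Finset (Fin n → ℤ))
    (hU_ne : U.Nonempty)
    (hU_sub : ∀ u ∈ U, ∃ j : Fin (k + 1), u ∈ E j)
    (a : (Fin n → ℤ) → ℚ)
    (ha_pos : ∀ u ∈ U, 0 < a u)
    (horth : ∀ j : Fin k, ∑ u ∈ U, a u * (v j u : ℚ) = 0) :
    ∃ u ∈ U, u ∈ E (Fin.last k) := by
  choose! idx h_idx using hU_sub
  obtain ⟨w, hwU, hw_max⟩ := U.exists_max_image idx hU_ne
  refine ⟨w, hwU, ?_⟩
  rcases Fin.eq_castSucc_or_eq_last (idx w) with ⟨i, hi⟩ | hlast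
  · -- The pairing of `v i` with the combination is negative, as `i` is the largest index met by `U`.
    have hvw : v i w = -1 := hv1 i w (hi ▸ h_idx w hwU)
    have hv_nonpos : ∀ u ∈ U, v i u ≤ 0 := by
      intro u hu
      rcases (hi ▸ hw_max u hu : idx u ≤ i.castSucc).lt_or_eq with hlt | heq
      · exact (hv3 i _ hlt u (h_idx u hu)).le
      · have hvu : v i u = -1 := hv1 i u (heq ▸ h_idx u hu)
        lia
    have hneg : ∑ u ∈ U, a u * (v i u : ℚ) < 0 := by
      refine Finset.sum_neg' (fun u hu => ?_) ⟨w, hwU, ?_⟩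
      · exact mul_nonpos_of_nonneg_of_nonpos (ha_pos u hu).le (mod_cast hv_nonpos u hu)
      · simpa [hvw] using ha_pos w hwU
    exact absurd (horth i) hneg.ne
  · exact hlast ▸ h_idx w hwU
end

section
/- Let Σ[1] = E_1 ⊔ … ⊔ E_{k+1} be a finite subset of M partitioned into pairwise disjoint nonempty subsets, let V = {v_1, …, v_k} be an amenable collection subordinate to E_1, …, E_{k+1}, let C ⊆ Σ[1] be a finite subset, and let p ∈ C ∩ E_{k+1}. Assume that for each i ∈ {1, …, k} either E_i ∩ C ≠ ∅, or ⟨v_i, u⟩ = 0 for all u ∈ C. Then there exist, for each index i with E_i ∩ C ≠ ∅, an element u_i ∈ E_i ∩ C and a nonnegative integer n_i, such that the element q = p + Σ_i n_i u_i of M satisfies ⟨v_j, q⟩ = 0 for every j = 1, …, k. -/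
/-- An upper triangular integral system with diagonal entries `-1`, nonnegative entries above the
diagonal and nonnegative constant term has a solution in natural numbers. -/
theorem exists_nat_solution_of_upper_triangular (k : ℕ) (a : Fin k → Fin k → ℤ) (b : Fin k → ℤ)
    (hb : ∀ j, 0 ≤ b j) (hdiag : ∀ j, a j j = -1) (hupper : ∀ j i, j < i → 0 ≤ a j i)
    (hlower : ∀ j i, i < j → a j i = 0) :
    ∃ x : Fin k → ℕ, ∀ j, b j + ∑ i, (x i : ℤ) * a j i = 0 := by
  induction k with
  | zero => exact ⟨0, fun j => j.elim0⟩
  | succ k ih =>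
    obtain ⟨x, hx⟩ := ih (fun j i => a j.succ i.succ) (fun j => b j.succ) (fun j => hb _)
      (fun j => hdiag _) (fun j i h => hupper _ _ (Fin.succ_lt_succ_iff.2 h))
      (fun j i h => hlower _ _ (Fin.succ_lt_succ_iff.2 h))
    have hnonneg : 0 ≤ b 0 + ∑ i : Fin k, (x i : ℤ) * a 0 i.succ :=
      add_nonneg (hb 0) (Finset.sum_nonneg fun i _ =>
        mul_nonneg (Int.natCast_nonneg _) (hupper _ _ (Fin.succ_pos i)))
    refine ⟨Fin.cons (b 0 + ∑ i : Fin k, (x i : ℤ) * a 0 i.succ).toNat x, fun j => ?_⟩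
    rw [Fin.sum_univ_succ]
    simp only [Fin.cons_zero, Fin.cons_succ, Int.toNat_of_nonneg hnonneg]
    cases j using Fin.cases with
    | zero => rw [hdiag]; ring
    | succ j => rw [hlower _ _ (Fin.succ_pos j), mul_zero, zero_add]; exact hx j

/-- existence core of Proposition on height-one points.  Let
`Σ[1] = E 1 ⊔ … ⊔ E (k+1) ⊆ M = Fin n → ℤ` be partitioned into pairwise disjoint
nonempty subsets with amenable collection `v 1, …, v k`, let `C ⊆ Σ[1]` be a finite
subset and `p ∈ C ∩ E (k+1)`.  Assume that for each `i` either `E i ∩ C ≠ ∅` or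
`⟨v i, u⟩ = 0` for all `u ∈ C`.  Then there exist, for each index `i` with
`E i ∩ C ≠ ∅`, an element `u i ∈ E i ∩ C` and a nonnegative integer `nn i` (with
`nn i = 0` for the other indices), such that `q = p + Σ_i (nn i) • u i` satisfies
`⟨v j, q⟩ = 0` for every `j`. -/
theorem amenable_exists_orthogonal_point_in_cone
    (n k : ℕ)
    (E : Fin (k + 1) → Finset (Fin n → ℤ))
    (hE_ne : ∀ j, (E j).Nonempty)
    (hE_disj : ∀ j j' : Fin (k + 1), j ≠ j' → Disjoint (E j) (E j'))
    (v : Fin k → ((Fin n → ℤ) →ₗ[ℤ] ℤ))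
    (hv1 : ∀ i : Fin k, ∀ ρ ∈ E i.castSucc, v i ρ = -1)
    (hv2 : ∀ i : Fin k, ∀ j : Fin (k + 1), i.castSucc < j → ∀ ρ ∈ E j, 0 ≤ v i ρ)
    (hv3 : ∀ i : Fin k, ∀ j : Fin (k + 1), j < i.castSucc → ∀ ρ ∈ E j, v i ρ = 0)
    (C : Finset (Fin n → ℤ))
    (hC_sub : ∀ u ∈ C, ∃ j : Fin (k + 1), u ∈ E j)
    (p : Fin n → ℤ) (hpC : p ∈ C) (hpE : p ∈ E (Fin.last k))
    (hdich : ∀ i : Fin k, (E i.castSucc ∩ C).Nonempty ∨ ∀ u ∈ C, v i u = 0) :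
    ∃ (u : Fin k → (Fin n → ℤ)) (nn : Fin k → ℕ),
      (∀ i : Fin k, (E i.castSucc ∩ C).Nonempty → u i ∈ E i.castSucc ∩ C) ∧
      (∀ i : Fin k, ¬ (E i.castSucc ∩ C).Nonempty → nn i = 0) ∧
      (∀ j : Fin k, v j (p + ∑ i : Fin k, nn i • u i) = 0) := by
  have hchoice : ∀ i : Fin k, ∃ w : Fin n → ℤ,
      ((E i.castSucc ∩ C).Nonempty → w ∈ E i.castSucc ∩ C) ∧
      (¬ (E i.castSucc ∩ C).Nonempty → w = 0) := by
    intro i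
    by_cases h : (E i.castSucc ∩ C).Nonempty
    · exact ⟨h.choose, fun _ => h.choose_spec, fun h' => absurd h h'⟩
    · exact ⟨0, fun h' => absurd h' h, fun _ => rfl⟩
  choose u hu hu0 using hchoice
  have hmem : ∀ i, u i ∈ E i.castSucc ∩ C ∨ u i = 0 := fun i =>
    (em _).imp (hu i) (hu0 i)
  have hvanish : ∀ j, ¬ (E j.castSucc ∩ C).Nonempty → ∀ i, v j (u i) = 0 := by
    intro j hj i
    rcases hmem i with h | h
    · exact (hdich j).resolve_left hj _ (Finset.mem_inter.1 h).2
    · rw [h, map_zero]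
  obtain ⟨x, hx⟩ := exists_nat_solution_of_upper_triangular k
    (fun j i => if j = i then -1 else v j (u i)) (fun j => v j p)
    (fun j => hv2 j _ (Fin.castSucc_lt_last j) p hpE) (fun j => if_pos rfl)
    (fun j i hji => by
      rw [if_neg hji.ne]
      rcases hmem i with h | h
      · exact hv2 j _ (Fin.castSucc_lt_castSucc_iff.2 hji) _ (Finset.mem_inter.1 h).1
      · rw [h, map_zero])
    (fun j i hij => by
      rw [if_neg hij.ne']
      rcases hmem i with h | h
      · exact hv3 j _ (Fin.castSucc_lt_castSucc_iff.2 hij) _ (Finset.mem_inter.1 h).1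
      · rw [h, map_zero])
  refine ⟨u, x, hu, fun j hj => ?_, fun j => ?_⟩
  · have h := hx j
    simp only [hvanish j hj, (hdich j).resolve_left hj p hpC] at h
    simpa using h
  · simp only [map_add, map_sum, map_nsmul]
    simp only [nsmul_eq_mul]
    by_cases hj : (E j.castSucc ∩ C).Nonempty
    · rw [← hx j]
      congr 1
      refine Finset.sum_congr rfl fun i _ => ?_
      split_ifs with h
      · subst h
        rw [hv1 j _ (Finset.mem_inter.1 (hu j hj)).1]
      · rfl
    · simp [hvanish j hj, (hdich j).resolve_left hj p hpC]
end

section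
/- Let Σ[1] = E_1 ⊔ … ⊔ E_{k+1} ⊆ M with amenable collection v_1, …, v_k, and suppose there are finitely many vectors w_1, …, w_r ∈ N ⊗_ℤ ℚ such that the function φ : M ⊗_ℤ ℚ → ℚ defined by φ(x) = max_{1 ≤ s ≤ r} ⟨w_s, x⟩ satisfies φ(ρ) = 1 for every ρ ∈ E_{k+1} and φ(ρ) = 0 for every ρ ∈ E_j with 1 ≤ j ≤ k. Then for every p ∈ E_{k+1}, every ℓ ≥ 0, and every choice of elements u'_1, …, u'_ℓ ∈ E_1 ∪ … ∪ E_k (repetitions allowed), one has φ(p + u'_1 + … + u'_ℓ) ≤ 1. In particular every point q ∈ M with ⟨v_i, q⟩ = 0 for all i that is expressible as such a sum lies in the polyhedron Δ_V = { x : ⟨v_i, x⟩ = 0 for 1 ≤ i ≤ k and φ(x) ≤ 1 }. -/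
/-- A linear functional that is nonpositive on the integral vectors of a list is nonpositive on
their sum. -/
theorem apply_intCast_list_sum_nonpos {n : ℕ} (f : (Fin n → ℚ) →ₗ[ℚ] ℚ) (l : List (Fin n → ℤ))
    (h : ∀ u ∈ l, f (fun t => (u t : ℚ)) ≤ 0) : f (fun t => (l.sum t : ℚ)) ≤ 0 := by
  induction l with
  | nil =>
    have h0 : (fun t => (((List.nil : List (Fin n → ℤ)).sum t : ℤ) : ℚ)) = 0 := by
      ext t; simp
    rw [h0, map_zero]
  | cons a l ih =>
    have hadd : (fun t => (((a :: l).sum t : ℤ) : ℚ)) =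
        (fun t => (a t : ℚ)) + fun t => (l.sum t : ℚ) := by
      ext t; simp
    rw [hadd, map_add]
    exact add_nonpos (h a List.mem_cons_self) (ih fun u hu => h u (List.mem_cons_of_mem a hu))

/-- Newton polytope of the Laurent superpotential is contained in
`Δ_V`.  Let `Σ[1] = E 1 ⊔ … ⊔ E (k+1) ⊆ M = Fin n → ℤ` with amenable collection
`v 1, …, v k`, and suppose `φ : M ⊗ ℚ → ℚ` is given by `φ(x) = max_s ⟨w s, x⟩` for
finitely many vectors `w s ∈ N ⊗ ℚ`, with `φ = 1` on `E (k+1)` and `φ = 0` on every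
other `E j`.  Then for every `p ∈ E (k+1)` and every finite list of elements of
`E 1 ∪ … ∪ E k` (repetitions allowed) we have `φ(p + u'_1 + … + u'_ℓ) ≤ 1`; in
particular every `q ∈ M` orthogonal to all `v i` and expressible as such a sum lies in
the polyhedron `Δ_V = {x : ⟨v i, x⟩ = 0 ∀ i, φ(x) ≤ 1}`. -/
theorem laurent_newton_polytope_in_DeltaV
    (n k r : ℕ)
    (E : Fin (k + 1) → Finset (Fin n → ℤ))
    (hE_ne : ∀ j, (E j).Nonempty)
    (hE_disj : ∀ j j' : Fin (k + 1), j ≠ j' → Disjoint (E j) (E j'))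
    (v : Fin k → ((Fin n → ℤ) →ₗ[ℤ] ℤ))
    (hv1 : ∀ i : Fin k, ∀ ρ ∈ E i.castSucc, v i ρ = -1)
    (hv2 : ∀ i : Fin k, ∀ j : Fin (k + 1), i.castSucc < j → ∀ ρ ∈ E j, 0 ≤ v i ρ)
    (hv3 : ∀ i : Fin k, ∀ j : Fin (k + 1), j < i.castSucc → ∀ ρ ∈ E j, v i ρ = 0)
    (w : Fin r → ((Fin n → ℚ) →ₗ[ℚ] ℚ))
    (φ : (Fin n → ℚ) → ℚ)
    (hφ_max : ∀ x : Fin n → ℚ, (∃ s : Fin r, φ x = w s x) ∧ ∀ s : Fin r, w s x ≤ φ x)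
    (hφ_one : ∀ ρ ∈ E (Fin.last k), φ (fun t => (ρ t : ℚ)) = 1)
    (hφ_zero : ∀ j : Fin (k + 1), j ≠ Fin.last k → ∀ ρ ∈ E j,
      φ (fun t => (ρ t : ℚ)) = 0) :
    (∀ p ∈ E (Fin.last k), ∀ l : List (Fin n → ℤ),
      (∀ u' ∈ l, ∃ i : Fin k, u' ∈ E i.castSucc) →
      φ (fun t => (((p + l.sum) t : ℤ) : ℚ)) ≤ 1) ∧
    (∀ q : Fin n → ℤ, (∀ i : Fin k, v i q = 0) →
      (∃ p ∈ E (Fin.last k), ∃ l : List (Fin n → ℤ),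
        (∀ u' ∈ l, ∃ i : Fin k, u' ∈ E i.castSucc) ∧ q = p + l.sum) →
      ((∀ i : Fin k, v i q = 0) ∧ φ (fun t => (q t : ℚ)) ≤ 1)) := by
  have key : ∀ p ∈ E (Fin.last k), ∀ l : List (Fin n → ℤ),
      (∀ u' ∈ l, ∃ i : Fin k, u' ∈ E i.castSucc) →
      φ (fun t => (((p + l.sum) t : ℤ) : ℚ)) ≤ 1 := by
    intro p hp l hl
    obtain ⟨s, hs⟩ := (hφ_max (fun t => (((p + l.sum) t : ℤ) : ℚ))).1
    have hadd : (fun t => (((p + l.sum) t : ℤ) : ℚ)) =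
        (fun t => (p t : ℚ)) + fun t => (l.sum t : ℚ) := by
      ext t; simp
    have hp_le : w s (fun t => (p t : ℚ)) ≤ 1 := hφ_one p hp ▸ (hφ_max _).2 s
    have hl_le : w s (fun t => (l.sum t : ℚ)) ≤ 0 := by
      refine apply_intCast_list_sum_nonpos (w s) l fun u hu => ?_
      obtain ⟨i, hi⟩ := hl u hu
      exact hφ_zero _ (Fin.castSucc_lt_last i).ne u hi ▸ (hφ_max _).2 s
    rw [hs, hadd, map_add]
    linarith
  refine ⟨key, ?_⟩
  rintro q hq ⟨p, hp, l, hl, rfl⟩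
  exact ⟨hq, key p hp l hl⟩
end
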